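/- arXiv:2104.11610 — 2 statements merged into one kernel-verified Lean document; each statement's English description precedes it below -/
import Mathlib

section
/- Let d ≥ 3 be an integer, let μ > 0 and N > 0, and let ρ > 0 satisfy (N/(ρ²·√π))·(Γ(d/2)/Γ((d−1)/2))·∫_{u=1}^{1+4ρ²/N} ((N/(2ρ²))·(u−1))^{(d−1)/2}·(2−(N/(2ρ²))·(u−1))^{(d−3)/2}/u du = 1/μ. Then for every point z₀ ∈ S_ρ, ∫_{S_ρ} 2μ·(z₀−z)/(1+‖z₀−z‖²/N) dσ_ρ(z) = z₀; that is, the uniform distribution on the sphere of radius ρ is a stationary point of the eccentric loss l_{μ,N}. -/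
open MeasureTheory Metric Real

/-- The uniform probability measure on the sphere of radius `ρ` centered at the
origin in `ℝ^d`, obtained by pushing forward the normalized surface measure on
the unit sphere along scalar multiplication by `ρ`. -/
noncomputable def sphereUniform (d : ℕ) (ρ : ℝ) :
    Measure (EuclideanSpace ℝ (Fin d)) :=
  Measure.map
    (fun z : sphere (0 : EuclideanSpace ℝ (Fin d)) 1 =>
      ρ • (z : EuclideanSpace ℝ (Fin d)))
    (((volume : Measure (EuclideanSpace ℝ (Fin d))).toSphere Set.univ)⁻¹ •
      (volume : Measure (EuclideanSpace ℝ (Fin d))).toSphere)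

open scoped RealInnerProductSpace

lemma integrableOn_pow_mul_exp_neg_sq (n : ℕ) :
    IntegrableOn (fun r : ℝ => r ^ n * exp (-r ^ 2)) (Set.Ioi 0) := by
  simpa using integrableOn_rpow_mul_exp_neg_mul_sq one_pos
    (s := n) (by linarith [(Nat.cast_nonneg n : (0 : ℝ) ≤ n)])

lemma integral_pow_mul_exp_neg_sq_pos (n : ℕ) :
    0 < ∫ r in Set.Ioi (0 : ℝ), r ^ n * exp (-r ^ 2) := by
  rw [setIntegral_pos_iff_support_of_nonneg_ae _ (integrableOn_pow_mul_exp_neg_sq n)]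
  · have : Set.Ioi (0 : ℝ) ⊆ Function.support (fun r : ℝ => r ^ n * exp (-r ^ 2)) := by
      intro r hr
      have : 0 < r := hr
      simp only [Function.mem_support]
      positivity
    rw [Set.inter_eq_right.2 this]
    simp
  · filter_upwards [ae_restrict_mem measurableSet_Ioi] with r hr
    have : 0 < r := hr
    simp only [Pi.zero_apply]
    positivity

lemma integral_eq_integral_line_prod_orthogonal {E : Type*} [NormedAddCommGroup E]
    [InnerProductSpace ℝ E] [FiniteDimensional ℝ E] [MeasurableSpace E] [BorelSpace E]
    (e : E) (he : ‖e‖ = 1) (g : E → ℝ) :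
    ∫ x, g x = ∫ p : ℝ × (ℝ ∙ e)ᗮ, g (p.1 • e + p.2) := by
  let Φ : ℝ × (ℝ ∙ e)ᗮ ≃ᵐ E :=
    ((LinearIsometryEquiv.toSpanUnitSingleton e he).toHomeomorph.toMeasurableEquiv.prodCongr
      (MeasurableEquiv.refl _)).trans <| (MeasurableEquiv.toLp 2 _).trans
        (ℝ ∙ e).orthogonalDecomposition.symm.toHomeomorph.toMeasurableEquiv
  have hΦ : MeasurePreserving Φ := by
    refine MeasurePreserving.trans (μb := volume) ?_ (MeasurePreserving.trans ?_
      (ℝ ∙ e).orthogonalDecomposition.symm.measurePreserving)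
    · exact (LinearIsometryEquiv.toSpanUnitSingleton e he).measurePreserving.prod
        (MeasurePreserving.id _)
    · exact WithLp.volume_preserving_toLp _ _
  rw [← hΦ.integral_comp']
  simp [Φ]
  rfl

/-- Polar coordinates in the upper half-plane. -/
lemma integral_prod_Ioi_polar (n : ℕ) (f : ℝ → ℝ) :
    ∫ p in Set.univ ×ˢ Set.Ioi (0 : ℝ), p.2 ^ n *
        (exp (-(p.1 ^ 2 + p.2 ^ 2)) * f ((√(p.1 ^ 2 + p.2 ^ 2))⁻¹ * p.1)) =
      (∫ r in Set.Ioi (0 : ℝ), r ^ (n + 1) * exp (-r ^ 2)) *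
        ∫ θ in (0 : ℝ)..π, sin θ ^ n * f (cos θ) := by
  rw [← integral_indicator (MeasurableSet.univ.prod measurableSet_Ioi),
    ← integral_comp_polarCoord_symm]
  have h : ∀ p ∈ polarCoord.target, p.1 •
      ((Set.univ ×ˢ Set.Ioi (0 : ℝ)).indicator (fun p : ℝ × ℝ => p.2 ^ n *
        (exp (-(p.1 ^ 2 + p.2 ^ 2)) * f ((√(p.1 ^ 2 + p.2 ^ 2))⁻¹ * p.1))) (polarCoord.symm p)) =
      (p.1 ^ (n + 1) * exp (-p.1 ^ 2)) *
        (Set.Ioi (0 : ℝ)).indicator (fun θ => sin θ ^ n * f (cos θ)) p.2 := by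
    rintro ⟨r, θ⟩ ⟨hr, hθ⟩
    simp only [Set.mem_Ioi, Set.mem_Ioo] at hr hθ
    have hsq : (r * cos θ) ^ 2 + (r * sin θ) ^ 2 = r ^ 2 := by
      linear_combination r ^ 2 * sin_sq_add_cos_sq θ
    by_cases h0 : 0 < θ
    · have hs : 0 < r * sin θ := mul_pos hr (sin_pos_of_pos_of_lt_pi h0 hθ.2)
      rw [Set.indicator_of_mem (by simpa using hs), Set.indicator_of_mem (by simpa using h0)]
      simp only [polarCoord_symm_apply, hsq, sqrt_sq hr.le, smul_eq_mul,
        inv_mul_cancel_left₀ hr.ne']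
      ring
    · have hs : r * sin θ ≤ 0 := mul_nonpos_of_nonneg_of_nonpos hr.le
        (sin_nonpos_of_nonpos_of_neg_pi_le (not_lt.1 h0) hθ.1.le)
      rw [Set.indicator_of_notMem (by simpa using hs), Set.indicator_of_notMem (by simpa using h0)]
      simp
  rw [setIntegral_congr_fun polarCoord.open_target.measurableSet h, polarCoord_target,
    Measure.volume_eq_prod, setIntegral_prod_mul (fun r : ℝ => r ^ (n + 1) * exp (-r ^ 2)),
    setIntegral_indicator measurableSet_Ioi,
    intervalIntegral.integral_of_le pi_pos.le, integral_Ioc_eq_integral_Ioo]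
  congr 3
  ext θ
  simp only [Set.mem_inter_iff, Set.mem_Ioo, Set.mem_Ioi]
  constructor
  · rintro ⟨⟨-, h⟩, h'⟩; exact ⟨h', h⟩
  · rintro ⟨h', h⟩; exact ⟨⟨by linarith [pi_pos], h⟩, h'⟩

section Radial

variable {E : Type*} [NormedAddCommGroup E] [InnerProductSpace ℝ E] [FiniteDimensional ℝ E]
  [MeasurableSpace E] [BorelSpace E] [Nontrivial E]

lemma integrable_exp_neg_norm_sq : Integrable (fun x : E => exp (-‖x‖ ^ 2)) := by
  rw [integrable_fun_norm_addHaar volume (f := fun r => exp (-r ^ 2))]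
  exact integrableOn_pow_mul_exp_neg_sq _

/-- Spherical coordinates for the product of a Gaussian and a degree-zero homogeneous function. -/
lemma integral_exp_neg_norm_sq_smul {F : Type*} [NormedAddCommGroup F] [NormedSpace ℝ F]
    (g : E → F) :
    ∫ x : E, exp (-‖x‖ ^ 2) • g (‖x‖⁻¹ • x) =
      (∫ r in Set.Ioi (0 : ℝ), r ^ (Module.finrank ℝ E - 1) * exp (-r ^ 2)) •
        ∫ z : sphere (0 : E) 1, g z ∂(volume : Measure E).toSphere := by
  set μ : Measure E := volume
  calc
    ∫ x : E, exp (-‖x‖ ^ 2) • g (‖x‖⁻¹ • x) ∂μ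
        = ∫ x : ({(0)}ᶜ : Set E), exp (-‖x.1‖ ^ 2) • g (‖x.1‖⁻¹ • x.1) ∂(μ.comap (↑)) := by
      rw [integral_subtype_comap (measurableSet_singleton _).compl
        fun x ↦ exp (-‖x‖ ^ 2) • g (‖x‖⁻¹ • x), restrict_compl_singleton]
    _ = ∫ p, exp (-(p.2 : ℝ) ^ 2) • g (p.1 : E)
          ∂μ.toSphere.prod (.volumeIoiPow (Module.finrank ℝ E - 1)) := by
      rw [← μ.measurePreserving_homeomorphUnitSphereProd.integral_comp
        (Homeomorph.measurableEmbedding _)]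
      simp
    _ = (∫ r : Set.Ioi (0 : ℝ), exp (-(r : ℝ) ^ 2) ∂.volumeIoiPow (Module.finrank ℝ E - 1)) •
          ∫ z : sphere (0 : E) 1, g z ∂μ.toSphere := by
      rw [← integral_prod_swap]
      exact integral_prod_smul (fun r : Set.Ioi (0 : ℝ) => exp (-(r : ℝ) ^ 2))
        (fun z : sphere (0 : E) 1 => g z)
    _ = _ := by
      congr 1
      simp only [Measure.volumeIoiPow, ENNReal.ofReal]
      rw [integral_withDensity_eq_integral_smul,
        integral_subtype_comap measurableSet_Ioi fun a ↦
          Real.toNNReal (a ^ (Module.finrank ℝ E - 1)) • exp (-a ^ 2),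
        setIntegral_congr_fun measurableSet_Ioi fun x hx ↦ ?_]
      · simp only [NNReal.smul_def, smul_eq_mul]
        rw [Real.coe_toNNReal _ (pow_nonneg (Set.mem_Ioi.1 hx).le _)]
      · exact (measurable_subtype_coe.pow_const _).real_toNNReal

lemma integral_toSphere_comp_isometry {F : Type*} [NormedAddCommGroup F] [NormedSpace ℝ F]
    (R : E ≃ₗᵢ[ℝ] E) (g : E → F) :
    ∫ z : sphere (0 : E) 1, g (R z) ∂(volume : Measure E).toSphere =
      ∫ z : sphere (0 : E) 1, g z ∂(volume : Measure E).toSphere := by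
  have h := (R.measurePreserving).integral_comp R.toHomeomorph.measurableEmbedding
    (fun x : E => exp (-‖x‖ ^ 2) • g (‖x‖⁻¹ • x))
  have h' := integral_exp_neg_norm_sq_smul (fun x => g (R x))
  simp only [LinearIsometryEquiv.norm_map, ← map_smul] at h
  rw [h, integral_exp_neg_norm_sq_smul] at h'
  exact (smul_right_injective F (integral_pow_mul_exp_neg_sq_pos _).ne' h').symm

/-- The distribution of the inner product with a fixed unit vector under the surface measure
of the unit sphere. -/
lemma integral_toSphere_inner {n : ℕ} (hE : Module.finrank ℝ E = n + 2) (e : E) (he : ‖e‖ = 1)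
    (f : ℝ → ℝ) (hf : Continuous f) (C : ℝ) (hC : ∀ t, |f t| ≤ C) :
    ∫ z : sphere (0 : E) 1, f ⟪e, (z : E)⟫ ∂(volume : Measure E).toSphere =
      (n + 1) * (√π ^ (n + 1) / Gamma ((n + 1) / 2 + 1)) *
        ∫ θ in (0 : ℝ)..π, sin θ ^ n * f (cos θ) := by
  have hK : Module.finrank ℝ (ℝ ∙ e)ᗮ = n + 1 := by
    have := Submodule.finrank_add_finrank_orthogonal (ℝ ∙ e)
    rw [finrank_span_singleton (by rintro rfl; simp at he), hE] at this
    omega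
  have : Nontrivial (ℝ ∙ e)ᗮ := Module.nontrivial_of_finrank_pos (R := ℝ) (by omega)
  have hball : (volume : Measure (ℝ ∙ e)ᗮ).real (ball 0 1) =
      √π ^ (n + 1) / Gamma ((n + 1) / 2 + 1) := by
    rw [measureReal_def, InnerProductSpace.volume_ball, hK]
    simp only [ENNReal.ofReal_one, one_pow, one_mul]
    rw [ENNReal.toReal_ofReal]
    · push_cast; rfl
    · have : 0 < Gamma (((n + 1 : ℕ) : ℝ) / 2 + 1) := Gamma_pos_of_pos (by positivity)
      positivity
  refine mul_left_cancel₀ (integral_pow_mul_exp_neg_sq_pos (n + 1)).ne' ?_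
  have h1 := integral_exp_neg_norm_sq_smul (fun x : E => f ⟪e, x⟫)
  simp only [smul_eq_mul, hE, show n + 2 - 1 = n + 1 from rfl] at h1
  rw [← h1, integral_eq_integral_line_prod_orthogonal e he]
  have hperp : ∀ y : (ℝ ∙ e)ᗮ, ⟪e, (y : E)⟫ = 0 := fun y =>
    Submodule.mem_orthogonal_singleton_iff_inner_right.1 y.2
  have hnorm : ∀ p : ℝ × (ℝ ∙ e)ᗮ, ‖p.1 • e + (p.2 : E)‖ = √(p.1 ^ 2 + ‖p.2‖ ^ 2) := by
    intro p
    rw [eq_comm, sqrt_eq_iff_eq_sq (by positivity) (norm_nonneg _), sq ‖_ + _‖,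
      norm_add_sq_eq_norm_sq_add_norm_sq_real (by rw [inner_smul_left, hperp]; simp)]
    simp [norm_smul, he]
    ring
  have hin : ∀ p : ℝ × (ℝ ∙ e)ᗮ, ⟪e, p.1 • e + (p.2 : E)⟫ = p.1 := by
    intro p
    rw [inner_add_right, hperp, inner_smul_right, real_inner_self_eq_norm_sq, he]
    simp
  simp only [inner_smul_right, hin]
  simp only [hnorm]
  have hsqrt : ∀ s r : ℝ, √(s ^ 2 + r ^ 2) ^ 2 = s ^ 2 + r ^ 2 := fun s r => sq_sqrt (by positivity)
  simp only [hsqrt]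
  rw [Measure.volume_eq_prod, integral_prod]
  · have h2 : ∀ s : ℝ, ∫ y : (ℝ ∙ e)ᗮ, exp (-(s ^ 2 + ‖y‖ ^ 2)) * f ((√(s ^ 2 + ‖y‖ ^ 2))⁻¹ * s) =
        (n + 1) * (√π ^ (n + 1) / Gamma ((n + 1) / 2 + 1)) *
          ∫ r in Set.Ioi (0 : ℝ), r ^ n *
            (exp (-(s ^ 2 + r ^ 2)) * f ((√(s ^ 2 + r ^ 2))⁻¹ * s)) := by
      intro s
      rw [integral_fun_norm_addHaar volume
        (fun r => exp (-(s ^ 2 + r ^ 2)) * f ((√(s ^ 2 + r ^ 2))⁻¹ * s)), hball, hK]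
      simp [mul_assoc]
    simp only [h2]
    rw [integral_const_mul, mul_left_comm, ← integral_prod_Ioi_polar, Measure.volume_eq_prod,
      ← Measure.prod_restrict, Measure.restrict_univ, integral_prod]
    have hi : Integrable (fun p : ℝ × ℝ => exp (-p.1 ^ 2) * (p.2 ^ n * exp (-p.2 ^ 2)))
        (volume.prod (volume.restrict (Set.Ioi 0))) :=
      Integrable.mul_prod (by simpa using integrable_exp_neg_mul_sq one_pos)
        (integrableOn_pow_mul_exp_neg_sq n)
    refine (hi.bdd_mul (c := C) (f := fun p : ℝ × ℝ => f ((√(p.1 ^ 2 + p.2 ^ 2))⁻¹ * p.1))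
      ?_ (.of_forall fun p => hC _)).congr (.of_forall fun p => ?_)
    · exact (hf.measurable.comp (by fun_prop)).aestronglyMeasurable
    · simp only [neg_add, exp_add]; ring
  · have hi : Integrable (fun p : ℝ × (ℝ ∙ e)ᗮ => exp (-p.1 ^ 2) * exp (-‖p.2‖ ^ 2))
        (volume.prod volume) :=
      Integrable.mul_prod (by simpa using integrable_exp_neg_mul_sq one_pos)
        integrable_exp_neg_norm_sq
    refine (hi.bdd_mul (c := C) (f := fun p : ℝ × (ℝ ∙ e)ᗮ => f ((√(p.1 ^ 2 + ‖p.2‖ ^ 2))⁻¹ * p.1))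
      ?_ (.of_forall fun p => hC _)).congr (.of_forall fun p => ?_)
    · exact (hf.measurable.comp (by fun_prop)).aestronglyMeasurable
    · simp only [neg_add, exp_add]; ring

end Radial

lemma natCast_mul_real_volume_ball {E : Type*} [NormedAddCommGroup E] [InnerProductSpace ℝ E]
    [FiniteDimensional ℝ E] [MeasurableSpace E] [BorelSpace E] [Nontrivial E] :
    Module.finrank ℝ E * (volume : Measure E).real (ball 0 1) =
      2 * √π ^ Module.finrank ℝ E / Gamma (Module.finrank ℝ E / 2) := by
  have hd : 0 < (Module.finrank ℝ E : ℝ) := by exact_mod_cast Module.finrank_pos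
  have hG := Gamma_pos_of_pos (half_pos hd)
  rw [measureReal_def, InnerProductSpace.volume_ball, Gamma_add_one (by positivity)]
  simp only [ENNReal.ofReal_one, one_pow, one_mul]
  rw [ENNReal.toReal_ofReal (by positivity)]
  field_simp

lemma intervalIntegral_substitution_cos (m : ℕ) {a : ℝ} (ha : 0 < a) :
    ∫ u in (1 : ℝ)..(1 + 2 * a), (a⁻¹ * (u - 1)) ^ (((m : ℝ) + 2) / 2) *
        (2 - a⁻¹ * (u - 1)) ^ ((m : ℝ) / 2) / u =
      a * ∫ θ in (0 : ℝ)..π, sin θ ^ (m + 1) *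
        ((1 - cos θ) / (1 + a * |1 - cos θ|)) := by
  have h := intervalIntegral.integral_comp_mul_deriv' (a := 0) (b := π)
    (f := fun θ => 1 + a * (1 - cos θ)) (f' := fun θ => a * sin θ)
    (g := fun u => (a⁻¹ * (u - 1)) ^ (((m : ℝ) + 2) / 2) *
        (2 - a⁻¹ * (u - 1)) ^ ((m : ℝ) / 2) / u) ?_ (by fun_prop) ?_
  · have e1 : 1 + a * (1 - cos 0) = 1 := by simp
    have e2 : 1 + a * (1 - cos π) = 1 + 2 * a := by simp; ring
    rw [e1, e2] at h
    rw [← h, ← intervalIntegral.integral_const_mul]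
    refine intervalIntegral.integral_congr fun θ hθ => ?_
    rw [Set.uIcc_of_le pi_pos.le] at hθ
    have hs : 0 ≤ sin θ := sin_nonneg_of_mem_Icc hθ
    have h1 : 0 ≤ 1 - cos θ := by linarith [cos_le_one θ]
    have h2 : 0 ≤ 1 + cos θ := by linarith [neg_one_le_cos θ]
    have h3 : a⁻¹ * (1 + a * (1 - cos θ) - 1) = 1 - cos θ := by field_simp; ring
    have h4 : (1 - cos θ) ^ ((m : ℝ) / 2) * (1 + cos θ) ^ ((m : ℝ) / 2) = sin θ ^ m := by
      rw [← mul_rpow h1 h2, show (1 - cos θ) * (1 + cos θ) = sin θ ^ (2 : ℝ) by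
        rw [rpow_two]; linear_combination -sin_sq_add_cos_sq θ, ← rpow_mul hs,
        mul_div_cancel₀ _ two_ne_zero, rpow_natCast]
    simp only [Function.comp, h3, abs_of_nonneg h1]
    rw [show 2 - (1 - cos θ) = 1 + cos θ by ring,
      show ((m : ℝ) + 2) / 2 = (m : ℝ) / 2 + 1 by ring, rpow_add_one' h1 (by positivity),
      pow_succ, ← h4]
    ring
  · intro θ _
    simpa using (((hasDerivAt_cos θ).const_sub 1).const_mul a).const_add 1
  · rintro _ ⟨θ, -, rfl⟩
    refine ContinuousAt.continuousWithinAt ?_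
    have h1 : 0 ≤ 1 - cos θ := by linarith [cos_le_one θ]
    refine ContinuousAt.div (ContinuousAt.mul ?_ ?_) continuousAt_id ?_
    · exact ContinuousAt.rpow_const (by fun_prop) (.inr (by positivity))
    · exact ContinuousAt.rpow_const (by fun_prop) (.inr (by positivity))
    · positivity

lemma continuous_repulsion {E : Type*} [NormedAddCommGroup E] [NormedSpace ℝ E]
    (μ : ℝ) {N : ℝ} (hN : 0 < N) (z₀ : E) :
    Continuous fun z : E => (2 * μ / (1 + ‖z₀ - z‖ ^ 2 / N)) • (z₀ - z) := by
  refine .smul (.div (by fun_prop) (by fun_prop) fun z => ?_) (by fun_prop)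
  positivity

lemma integral_sphereUniform {d : ℕ} {F : Type*} [NormedAddCommGroup F] [NormedSpace ℝ F]
    (ρ : ℝ) {g : EuclideanSpace ℝ (Fin d) → F} (hg : Continuous g) :
    ∫ z, g z ∂(sphereUniform d ρ) =
      ((volume : Measure (EuclideanSpace ℝ (Fin d))).toSphere.real Set.univ)⁻¹ •
        ∫ z : sphere (0 : EuclideanSpace ℝ (Fin d)) 1, g (ρ • (z : EuclideanSpace ℝ (Fin d)))
          ∂(volume : Measure (EuclideanSpace ℝ (Fin d))).toSphere := by
  rw [sphereUniform, integral_map (by fun_prop) hg.aestronglyMeasurable, integral_smul_measure,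
    ENNReal.toReal_inv, measureReal_def]

/-- If `ρ` satisfies the integral equation of Theorem 1, then the uniform
distribution on the sphere of radius `ρ` is a stationary point of the eccentric
loss `l_{μ,N}`: for every `z₀` on the sphere, the aggregated repulsive force
equals `z₀`. -/
theorem sphere_stationary
    (d : ℕ) (hd : 3 ≤ d) (μ N ρ : ℝ) (hμ : 0 < μ) (hN : 0 < N) (hρ : 0 < ρ)
    (hint :
      N / (ρ ^ 2 * Real.sqrt π) *
          (Real.Gamma ((d : ℝ) / 2) / Real.Gamma (((d : ℝ) - 1) / 2)) *
          ∫ u in (1 : ℝ)..(1 + 4 * ρ ^ 2 / N),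
            (N / (2 * ρ ^ 2) * (u - 1)) ^ (((d : ℝ) - 1) / 2) *
              (2 - N / (2 * ρ ^ 2) * (u - 1)) ^ (((d : ℝ) - 3) / 2) / u
        = 1 / μ) :
    ∀ z₀ ∈ sphere (0 : EuclideanSpace ℝ (Fin d)) ρ,
      ∫ z, (2 * μ / (1 + ‖z₀ - z‖ ^ 2 / N)) • (z₀ - z) ∂(sphereUniform d ρ)
        = z₀ := by
  intro z₀ hz₀
  obtain ⟨m, rfl⟩ := Nat.exists_eq_add_of_le' hd
  replace hz₀ : ‖z₀‖ = ρ := by simpa using hz₀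
  have hE : Module.finrank ℝ (EuclideanSpace ℝ (Fin (m + 3))) = m + 3 := finrank_euclideanSpace_fin
  set σ := (volume : Measure (EuclideanSpace ℝ (Fin (m + 3)))).toSphere
  set G : EuclideanSpace ℝ (Fin (m + 3)) → EuclideanSpace ℝ (Fin (m + 3)) := fun z =>
    (2 * μ / (1 + ‖z₀ - z‖ ^ 2 / N)) • (z₀ - z)
  have hG : Continuous G := continuous_repulsion μ hN z₀
  rw [integral_sphereUniform ρ hG]
  set V := ∫ z : sphere (0 : EuclideanSpace ℝ (Fin (m + 3))) 1,
    G (ρ • (z : EuclideanSpace ℝ (Fin (m + 3)))) ∂σ with hV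
  have hGi : Integrable (fun z : sphere (0 : EuclideanSpace ℝ (Fin (m + 3))) 1 =>
      G (ρ • (z : EuclideanSpace ℝ (Fin (m + 3))))) σ :=
    Continuous.integrable_of_hasCompactSupport (by fun_prop)
      (HasCompactSupport.of_compactSpace _)
  set R := (ℝ ∙ z₀).reflection
  have hRz : R z₀ = z₀ :=
    Submodule.reflection_mem_subspace_eq_self (Submodule.mem_span_singleton_self z₀)
  have hRG : ∀ z, R (G z) = G (R z) := by
    intro z
    have : z₀ - R z = R (z₀ - z) := by rw [map_sub, hRz]
    simp only [G, this, map_smul, LinearIsometryEquiv.norm_map]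
  have hRV : R V = V := by
    rw [hV, ← R.coe_coe'', ← ContinuousLinearMap.integral_comp_comm _ hGi]
    simpa [hRG] using integral_toSphere_comp_isometry R (fun z => G (ρ • z))
  obtain ⟨k, hk⟩ := Submodule.mem_span_singleton.1 ((Submodule.reflection_eq_self_iff V).1 hRV)
  set a : ℝ := 2 * ρ ^ 2 / N with ha_def
  have ha : 0 < a := by positivity
  set f : ℝ → ℝ := fun t => (1 - t) / (1 + a * |1 - t|) with hf_def
  have hf : Continuous f := by
    refine .div (by fun_prop) (by fun_prop) fun t => ?_
    positivity
  have hfC : ∀ t, |f t| ≤ 1 / a := by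
    intro t
    have : 0 < 1 + a * |1 - t| := by positivity
    rw [hf_def, abs_div, abs_of_pos this, div_le_div_iff₀ this ha]
    linarith
  have hinner : ∀ z : sphere (0 : EuclideanSpace ℝ (Fin (m + 3))) 1,
      ⟪z₀, G (ρ • (z : EuclideanSpace ℝ (Fin (m + 3))))⟫ =
        2 * μ * ρ ^ 2 * f ⟪ρ⁻¹ • z₀, (z : EuclideanSpace ℝ (Fin (m + 3)))⟫ := by
    intro z
    have hz : ‖(z : EuclideanSpace ℝ (Fin (m + 3)))‖ = 1 := by simp
    set t := ⟪ρ⁻¹ • z₀, (z : EuclideanSpace ℝ (Fin (m + 3)))⟫ with ht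
    have ht' : ⟪z₀, (z : EuclideanSpace ℝ (Fin (m + 3)))⟫ = ρ * t := by
      rw [ht, real_inner_smul_left, mul_inv_cancel_left₀ hρ.ne']
    have ht1 : t ≤ 1 := by
      have h := real_inner_le_norm z₀ (z : EuclideanSpace ℝ (Fin (m + 3)))
      rw [ht', hz₀, hz] at h
      nlinarith
    have h1 : ‖z₀ - ρ • (z : EuclideanSpace ℝ (Fin (m + 3)))‖ ^ 2 = 2 * ρ ^ 2 * (1 - t) := by
      rw [norm_sub_sq_real, norm_smul, hz, hz₀, real_inner_smul_right, ht', norm_eq_abs,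
        abs_of_pos hρ]
      ring
    simp only [G, hf_def]
    rw [h1, real_inner_smul_right, inner_sub_right, real_inner_smul_right, ht',
      real_inner_self_eq_norm_sq, hz₀, abs_of_nonneg (by linarith), ha_def]
    ring
  have hVin : ⟪z₀, V⟫ = 2 * μ * ρ ^ 2 * ((2 * √π ^ (m + 2) / Gamma (((m : ℝ) + 2) / 2)) *
      ∫ θ in (0 : ℝ)..π, sin θ ^ (m + 1) * f (cos θ)) := by
    rw [hV, ← integral_inner hGi]
    simp only [hinner]
    rw [integral_const_mul, integral_toSphere_inner hE _ _ f hf _ hfC]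
    · congr 2
      push_cast
      rw [show (m : ℝ) + 1 + 1 = m + 2 by ring, Gamma_add_one (by positivity)]
      have := Gamma_pos_of_pos (show 0 < ((m : ℝ) + 2) / 2 by positivity)
      field_simp
    · rw [norm_smul, hz₀, norm_inv, norm_eq_abs, abs_of_pos hρ, inv_mul_cancel₀ hρ.ne']
  have hσ : σ.real Set.univ = 2 * √π ^ (m + 3) / Gamma (((m : ℝ) + 3) / 2) := by
    rw [Measure.toSphere_real_apply_univ, natCast_mul_real_volume_ball, hE]
    push_cast
    rfl
  have hsub := intervalIntegral_substitution_cos m ha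
  push_cast at hint
  rw [show N / (2 * ρ ^ 2) = a⁻¹ by rw [ha_def, inv_div],
    show 4 * ρ ^ 2 / N = 2 * a by rw [ha_def]; ring, show (m : ℝ) + 3 - 1 = m + 2 by ring,
    show (m : ℝ) + 3 - 3 = m by ring, hsub] at hint
  set J := ∫ θ in (0 : ℝ)..π, sin θ ^ (m + 1) * f (cos θ) with hJ
  have hk' : k * ρ ^ 2 = ⟪z₀, V⟫ := by
    rw [← hk, real_inner_smul_right, real_inner_self_eq_norm_sq, hz₀]
  have hG2 := Gamma_pos_of_pos (show 0 < ((m : ℝ) + 2) / 2 by positivity)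
  have hG3 := Gamma_pos_of_pos (show 0 < ((m : ℝ) + 3) / 2 by positivity)
  have hπ : 0 < √π := sqrt_pos.2 pi_pos
  have hkσ : k = σ.real Set.univ := by
    change N / (ρ ^ 2 * √π) * (Gamma (((m : ℝ) + 3) / 2) / Gamma (((m : ℝ) + 2) / 2)) *
      (a * J) = 1 / μ at hint
    rw [hVin] at hk'
    rw [hσ]
    have hint' : 2 * μ * J * Gamma (((m : ℝ) + 3) / 2) = √π * Gamma (((m : ℝ) + 2) / 2) := by
      rw [ha_def] at hint
      field_simp at hint
      linarith
    have hk2 : k = 2 * μ * (2 * √π ^ (m + 2) / Gamma (((m : ℝ) + 2) / 2) * J) :=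
      mul_right_cancel₀ (pow_pos hρ 2).ne' (by linarith)
    rw [hk2, pow_succ √π (m + 2)]
    field_simp
    linear_combination hint'
  have hσpos : 0 < σ.real Set.univ := by rw [hσ]; positivity
  rw [← hk, hkσ, smul_smul, inv_mul_cancel₀ hσpos.ne', one_smul]
end

section
/- Let d ≥ 4 be an integer and a > 0, and suppose u* ∈ [1, 1+2/a] is a point at which f_{d,a} attains its maximum over the interval [1, 1+2/a]. Then u* lies in the open interval (1, 1+2/a) and satisfies a = (1 + 1/(u*(d−3)+1))/(u*−1). -/
open Real

/-- `f_{d,a}(u) = (2a/√π)·(Γ(d/2)/Γ((d−1)/2))·(a(u−1))^((d−1)/2)·(2−a(u−1))^((d−3)/2)/u`. -/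
noncomputable def eccentricF (d : ℕ) (a : ℝ) (u : ℝ) : ℝ :=
  2 * a / Real.sqrt π * (Real.Gamma ((d : ℝ) / 2) / Real.Gamma (((d : ℝ) - 1) / 2)) *
    (a * (u - 1)) ^ (((d : ℝ) - 1) / 2) * (2 - a * (u - 1)) ^ (((d : ℝ) - 3) / 2) / u

theorem eccentricF_pos {d : ℕ} (hd : 2 ≤ d) {a u : ℝ} (ha : 0 < a)
    (hu : u ∈ Set.Ioo 1 (1 + 2 / a)) : 0 < eccentricF d a u := by
  have hd' : (2 : ℝ) ≤ d := by exact_mod_cast hd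
  obtain ⟨h1, h2⟩ := hu
  have hx : 0 < a * (u - 1) := mul_pos ha (by linarith)
  have hy : 0 < 2 - a * (u - 1) := by
    have h : u - 1 < 2 / a := by linarith
    rw [lt_div_iff₀ ha] at h
    linarith
  have hG1 : 0 < Real.Gamma ((d : ℝ) / 2) := Real.Gamma_pos_of_pos (by linarith)
  have hG2 : 0 < Real.Gamma (((d : ℝ) - 1) / 2) := Real.Gamma_pos_of_pos (by linarith)
  have hu0 : 0 < u := by linarith
  unfold eccentricF
  positivity

theorem eccentricF_left {d : ℕ} (hd : 2 ≤ d) (a : ℝ) : eccentricF d a 1 = 0 := by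
  have hd' : (2 : ℝ) ≤ d := by exact_mod_cast hd
  have hp : ((d : ℝ) - 1) / 2 ≠ 0 := by linarith
  simp [eccentricF, Real.zero_rpow hp]

theorem eccentricF_right {d : ℕ} (hd : 4 ≤ d) {a : ℝ} (ha : a ≠ 0) :
    eccentricF d a (1 + 2 / a) = 0 := by
  have hd' : (4 : ℝ) ≤ d := by exact_mod_cast hd
  have hq : ((d : ℝ) - 3) / 2 ≠ 0 := by linarith
  have h : 2 - a * (1 + 2 / a - 1) = 0 := by field_simp; ring
  rw [eccentricF, h, Real.zero_rpow hq, mul_zero, zero_div]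

/-- The logarithmic derivative of `eccentricF d a`, multiplied by the function itself. -/
theorem hasDerivAt_eccentricF (d : ℕ) {a u : ℝ} (hx : a * (u - 1) ≠ 0)
    (hy : 2 - a * (u - 1) ≠ 0) (hu : u ≠ 0) :
    HasDerivAt (eccentricF d a)
      (eccentricF d a u * (((d : ℝ) - 1) / 2 * a / (a * (u - 1)) -
        ((d : ℝ) - 3) / 2 * a / (2 - a * (u - 1)) - 1 / u)) u := by
  have h1 : HasDerivAt (fun v : ℝ => a * (v - 1)) a u := by
    simpa using ((hasDerivAt_id u).sub_const 1).const_mul a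
  have h2 : HasDerivAt (fun v : ℝ => 2 - a * (v - 1)) (-a) u := h1.const_sub 2
  have h3 := h1.rpow_const (p := ((d : ℝ) - 1) / 2) (Or.inl hx)
  have h4 := h2.rpow_const (p := ((d : ℝ) - 3) / 2) (Or.inl hy)
  have h5 := ((h3.const_mul (2 * a / Real.sqrt π *
    (Real.Gamma ((d : ℝ) / 2) / Real.Gamma (((d : ℝ) - 1) / 2)))).mul h4).div (hasDerivAt_id u) hu
  refine h5.congr_deriv ?_
  rw [Real.rpow_sub_one hx, Real.rpow_sub_one hy]
  simp only [eccentricF, id, Pi.mul_apply]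
  generalize 2 * a / Real.sqrt π *
    (Real.Gamma ((d : ℝ) / 2) / Real.Gamma (((d : ℝ) - 1) / 2)) = C
  generalize (a * (u - 1)) ^ (((d : ℝ) - 1) / 2) = X
  generalize (2 - a * (u - 1)) ^ (((d : ℝ) - 3) / 2) = Y
  generalize a * (u - 1) = x at *
  generalize 2 - x = y at *
  field_simp
  ring

/-- Lemma 2(b): for `d ≥ 4` and `a > 0`, any maximizer `u*` of `f_{d,a}` over
`[1, 1+2/a]` lies in the open interval `(1, 1+2/a)` and satisfies
`a = (1 + 1/(u*(d−3)+1))/(u*−1)`. -/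
theorem eccentricF_maximizer
    (d : ℕ) (hd : 4 ≤ d) (a : ℝ) (ha : 0 < a) (ustar : ℝ)
    (hmem : ustar ∈ Set.Icc 1 (1 + 2 / a))
    (hmax : ∀ v ∈ Set.Icc (1 : ℝ) (1 + 2 / a), eccentricF d a v ≤ eccentricF d a ustar) :
    ustar ∈ Set.Ioo 1 (1 + 2 / a) ∧
      a = (1 + 1 / (ustar * ((d : ℝ) - 3) + 1)) / (ustar - 1) := by
  have hd' : (4 : ℝ) ≤ d := by exact_mod_cast hd
  have hmid : 1 + 1 / a ∈ Set.Ioo (1 : ℝ) (1 + 2 / a) := by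
    constructor
    · have : 0 < 1 / a := by positivity
      linarith
    · gcongr
      norm_num
  have hpos : 0 < eccentricF d a ustar :=
    (eccentricF_pos (by omega) ha hmid).trans_le (hmax _ (Set.Ioo_subset_Icc_self hmid))
  have hIoo : ustar ∈ Set.Ioo 1 (1 + 2 / a) := by
    refine ⟨lt_of_le_of_ne hmem.1 ?_, lt_of_le_of_ne hmem.2 ?_⟩
    · rintro rfl
      exact hpos.ne' (eccentricF_left (by omega) a)
    · rintro rfl
      exact hpos.ne' (eccentricF_right hd ha.ne')
  refine ⟨hIoo, ?_⟩
  obtain ⟨h1, h2⟩ := hIoo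
  have hs : 0 < ustar - 1 := by linarith
  have hu : 0 < ustar := by linarith
  have hy : 0 < 2 - a * (ustar - 1) := by
    have h : ustar - 1 < 2 / a := by linarith
    rw [lt_div_iff₀ ha] at h
    linarith
  have hloc : IsLocalMax (eccentricF d a) ustar := by
    filter_upwards [Icc_mem_nhds h1 h2] with v hv using hmax v hv
  have hcrit := (mul_eq_zero.mp (hloc.hasDerivAt_eq_zero
    (hasDerivAt_eccentricF d (mul_pos ha hs).ne' hy.ne' hu.ne'))).resolve_left hpos.ne'
  have hden : 0 < ustar * ((d : ℝ) - 3) + 1 := by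
    have : 0 < ustar * ((d : ℝ) - 3) := mul_pos hu (by linarith)
    linarith
  have hpoly : ((d : ℝ) - 1) * (2 - a * (ustar - 1)) * ustar
      - ((d : ℝ) - 3) * a * (ustar - 1) * ustar
      - 2 * (ustar - 1) * (2 - a * (ustar - 1)) = 0 := by
    have hs' := hs.ne'
    have hy' := hy.ne'
    have key : ((d : ℝ) - 1) * (2 - a * (ustar - 1)) * ustar
      - ((d : ℝ) - 3) * a * (ustar - 1) * ustar
      - 2 * (ustar - 1) * (2 - a * (ustar - 1)) =
      2 * (ustar - 1) * (2 - a * (ustar - 1)) * ustar *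
      (((d : ℝ) - 1) / 2 * a / (a * (ustar - 1)) -
        ((d : ℝ) - 3) / 2 * a / (2 - a * (ustar - 1)) - 1 / ustar) := by
      generalize hY : 2 - a * (ustar - 1) = y at *
      generalize ustar - 1 = s at *
      field_simp
    rw [key, hcrit, mul_zero]
  rw [eq_div_iff hs.ne', ← sub_eq_zero]
  field_simp
  linarith
end
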